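/- arXiv:1201.5084 — 4 statements merged into one kernel-verified Lean document; each statement's English description precedes it below -/
import Mathlib

section
/- For all s, t ≥ 0: if H is in (1/2, 1) then Σ_{j∈ℤ} (b a^j)^{1-2H} ∫_0^{s∧t} (1 - e^{-b a^j (t-r)})(1 - e^{-b a^j (s-r)}) dr = Q_H(s,t), and if H is in (1, 3/2) then the same left-hand side equals Q̃_H(s,t). (This is the analytic content of the representation of osfBm and onsfBm as Σ_{j∈ℤ} (b a^j)^{1/2-H} ∫_0^t (1 - e^{-b a^j (t-r)}) dβ^j_r with independent standard Brownian motions β^j.) -/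
open Real MeasureTheory

/-- The oscillatory function `h_t = Σ_{j∈ℤ} (b a^j t)^{-2H} (e^{-b a^j t} - 1 + b a^j t)`. -/
noncomputable def hosc (a b H t : ℝ) : ℝ :=
  ∑' j : ℤ, (b * a ^ j * t) ^ (-(2 * H)) *
    (Real.exp (-(b * a ^ j * t)) - 1 + b * a ^ j * t)

/-- The oscillatory sub-fractional Brownian motion covariance `Q_H(s,t)`. -/
noncomputable def Qcov (a b H s t : ℝ) : ℝ :=
  s ^ (2 * H) * hosc a b H s + t ^ (2 * H) * hosc a b H t
    - (1 / 2) * ((s + t) ^ (2 * H) * hosc a b H (s + t)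
      + |s - t| ^ (2 * H) * hosc a b H |s - t|)

/-- The oscillatory function
`h̃_t = Σ_{j∈ℤ} (b a^j t)^{-2H} (e^{-b a^j t} - 1 + b a^j t - (b a^j t)²/2)`. -/
noncomputable def htil (a b H t : ℝ) : ℝ :=
  ∑' j : ℤ, (b * a ^ j * t) ^ (-(2 * H)) *
    (Real.exp (-(b * a ^ j * t)) - 1 + b * a ^ j * t - (b * a ^ j * t) ^ 2 / 2)

/-- The oscillatory negative sub-fractional Brownian motion covariance `Q̃_H(s,t)`. -/
noncomputable def Qtil (a b H s t : ℝ) : ℝ :=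
  s ^ (2 * H) * htil a b H s + t ^ (2 * H) * htil a b H t
    - (1 / 2) * ((s + t) ^ (2 * H) * htil a b H (s + t)
      + |s - t| ^ (2 * H) * htil a b H |s - t|)

lemma osc_summable_rpow (a b : ℝ) (ha0 : 0 < a) (ha1 : a < 1) (hb : 0 < b) (p q C D : ℝ)
    (hp : p < 0) (hq : 0 < q) (g : ℝ → ℝ) (h1 : ∀ c, 0 < c → |g c| ≤ C * c ^ p)
    (h2 : ∀ c, 0 < c → |g c| ≤ D * c ^ q) : Summable (fun j : ℤ => g (b * a ^ j)) := by
  apply Summable.of_nat_of_neg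
  · have hs : Summable (fun n : ℕ => (D * b ^ q) * (a ^ q) ^ n) :=
      (summable_geometric_of_lt_one (by positivity)
        (Real.rpow_lt_one ha0.le ha1 hq)).mul_left _
    refine Summable.of_norm_bounded hs (fun n => ?_)
    refine (h2 _ (by positivity)).trans (le_of_eq ?_)
    rw [Real.mul_rpow hb.le (by positivity), zpow_natCast, ← Real.rpow_natCast a n,
      ← Real.rpow_natCast (a ^ q) n, ← Real.rpow_mul ha0.le, ← Real.rpow_mul ha0.le, mul_comm q]
    ring
  · have hs : Summable (fun n : ℕ => (C * b ^ p) * (a ^ (-p)) ^ n) :=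
      (summable_geometric_of_lt_one (by positivity)
        (Real.rpow_lt_one ha0.le ha1 (by linarith))).mul_left _
    refine Summable.of_norm_bounded hs (fun n => ?_)
    refine (h1 _ (by positivity)).trans (le_of_eq ?_)
    rw [Real.mul_rpow hb.le (by positivity), zpow_neg, zpow_natCast, ← Real.rpow_natCast a n,
      ← Real.rpow_natCast (a ^ (-p)) n, ← Real.rpow_neg ha0.le, ← Real.rpow_mul ha0.le,
      ← Real.rpow_mul ha0.le]
    ring_nf

lemma osc_key (a b : ℝ) (ha0 : 0 < a) (ha1 : a < 1) (hb : 0 < b) (H : ℝ) (m : ℕ)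
    (hm0 : 0 < m) (hm : (m : ℝ) < 2 * H) (hm' : 2 * H < m + 1) (φ : ℝ → ℝ)
    (h1 : ∀ x, 0 ≤ x → |φ x| ≤ x ^ m) (h2 : ∀ x, 0 ≤ x → |φ x| ≤ x ^ (m + 1))
    (t : ℝ) (ht : 0 ≤ t) :
    HasSum (fun j : ℤ => (b * a ^ j) ^ (-(2 * H)) * φ (b * a ^ j * t))
      (t ^ (2 * H) * ∑' j : ℤ, (b * a ^ j * t) ^ (-(2 * H)) * φ (b * a ^ j * t)) := by
  have hS : Summable (fun j : ℤ => (b * a ^ j) ^ (-(2 * H)) * φ (b * a ^ j * t)) := by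
    have gen : ∀ k : ℕ, (∀ x, 0 ≤ x → |φ x| ≤ x ^ k) → ∀ c : ℝ, 0 < c →
        |c ^ (-(2 * H)) * φ (c * t)| ≤ t ^ k * c ^ ((k : ℝ) - 2 * H) := by
      intro k hk c hc
      rw [abs_mul, abs_of_pos (Real.rpow_pos_of_pos hc _)]
      calc c ^ (-(2 * H)) * |φ (c * t)| ≤ c ^ (-(2 * H)) * (c * t) ^ k := by
            gcongr; exact hk _ (by positivity)
        _ = _ := by
            rw [sub_eq_add_neg, Real.rpow_add hc, Real.rpow_natCast, mul_pow]; ring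
    refine osc_summable_rpow a b ha0 ha1 hb _ _ _ _ ?_ ?_
      (fun c => c ^ (-(2 * H)) * φ (c * t)) (gen m h1) (gen (m + 1) h2)
    · linarith
    · push_cast; linarith
  convert hS.hasSum using 1
  rw [← tsum_mul_left]
  refine tsum_congr (fun j => ?_)
  rcases ht.eq_or_lt with rfl | ht
  · have : φ 0 = 0 := by
      have := h1 0 le_rfl
      rw [zero_pow hm0.ne'] at this
      exact abs_nonpos_iff.mp this
    simp [this]
  · have hc : 0 < b * a ^ j := by positivity
    rw [Real.mul_rpow hc.le ht.le, Real.rpow_neg ht.le]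
    have := (Real.rpow_pos_of_pos ht (2 * H)).ne'
    field_simp

lemma osc_int (c : ℝ) (hc : 0 < c) (s t m : ℝ) :
    ∫ r in (0:ℝ)..m, (1 - Real.exp (-(c * (t - r)))) * (1 - Real.exp (-(c * (s - r))))
    = m - (Real.exp (-(c * (t - m))) - Real.exp (-(c * t))) / c
      - (Real.exp (-(c * (s - m))) - Real.exp (-(c * s))) / c
      + (Real.exp (-(c * (s + t - 2 * m))) - Real.exp (-(c * (s + t)))) / (2 * c) := by
  have hd : ∀ u k r : ℝ, HasDerivAt (fun r => Real.exp (-(c * (u - k * r))))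
      (Real.exp (-(c * (u - k * r))) * (c * k)) r := by
    intro u k r
    have : HasDerivAt (fun r : ℝ => -(c * (u - k * r))) (c * k) r := by
      have := ((((hasDerivAt_id r).const_mul k).const_sub u).const_mul c).neg
      refine this.congr_deriv ?_
      ring
    exact this.exp
  rw [intervalIntegral.integral_eq_sub_of_hasDerivAt
    (f := fun r => r - Real.exp (-(c * (t - 1 * r))) / c - Real.exp (-(c * (s - 1 * r))) / c
      + Real.exp (-(c * (s + t - 2 * r))) / (2 * c))]
  · simp only [one_mul, mul_zero, sub_zero]; ring
  · intro r _
    have := ((((hasDerivAt_id r).sub ((hd t 1 r).div_const c)).sub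
      ((hd s 1 r).div_const c))).add ((hd (s + t) 2 r).div_const (2 * c))
    refine this.congr_deriv ?_
    have e : Real.exp (-(c * (s + t - 2 * r)))
      = Real.exp (-(c * (t - r))) * Real.exp (-(c * (s - r))) := by
      rw [← Real.exp_add]; ring_nf
    rw [e]; simp only [one_mul]; field_simp; ring
  · apply Continuous.intervalIntegrable; fun_prop

lemma osc_main (a b : ℝ) (ha0 : 0 < a) (ha1 : a < 1) (hb : 0 < b) (H : ℝ) (m : ℕ)
    (hm0 : 0 < m) (hm : (m : ℝ) < 2 * H) (hm' : 2 * H < m + 1) (φ : ℝ → ℝ)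
    (h1 : ∀ x, 0 ≤ x → |φ x| ≤ x ^ m) (h2 : ∀ x, 0 ≤ x → |φ x| ≤ x ^ (m + 1)) (k : ℝ)
    (hφ : ∀ x, φ x = Real.exp (-x) - 1 + x - k * x ^ 2)
    (h : ℝ → ℝ) (hh : ∀ t, h t = ∑' j : ℤ, (b * a ^ j * t) ^ (-(2 * H)) * φ (b * a ^ j * t))
    (s t : ℝ) (hs : 0 ≤ s) (ht : 0 ≤ t) :
    (∑' j : ℤ, (b * a ^ j) ^ (1 - 2 * H) *
        ∫ r in (0:ℝ)..(min s t),
          (1 - Real.exp (-(b * a ^ j * (t - r)))) * (1 - Real.exp (-(b * a ^ j * (s - r)))))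
      = s ^ (2 * H) * h s + t ^ (2 * H) * h t
    - (1 / 2) * ((s + t) ^ (2 * H) * h (s + t) + |s - t| ^ (2 * H) * h |s - t|) := by
  have K := osc_key a b ha0 ha1 hb H m hm0 hm hm' φ h1 h2
  simp only [← hh] at K
  refine HasSum.tsum_eq ?_
  have S := ((K s hs).add (K t ht)).sub
    (((K (s + t) (by positivity)).add (K |s - t| (abs_nonneg _))).mul_left (1 / 2))
  refine Eq.subst (motive := fun f => HasSum f _) (funext fun j => ?_) S
  symm
  have hc : 0 < b * a ^ j := by positivity
  generalize b * a ^ j = c at hc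
  rw [osc_int c hc, sub_eq_add_neg 1, Real.rpow_add hc, Real.rpow_one]
  simp only [hφ]
  rcases le_total s t with hst | hst
  · rw [min_eq_left hst, abs_of_nonpos (sub_nonpos.mpr hst)]
    rw [show s + t - 2 * s = t - s by ring, show -(s - t) = t - s by ring, sub_self, mul_zero,
      neg_zero, Real.exp_zero]
    field_simp; ring
  · rw [min_eq_right hst, abs_of_nonneg (sub_nonneg.mpr hst)]
    rw [show s + t - 2 * t = s - t by ring, sub_self, mul_zero,
      neg_zero, Real.exp_zero]
    field_simp; ring

lemma osc_exp_lower (x : ℝ) : 0 ≤ Real.exp (-x) - 1 + x := by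
  linarith [Real.add_one_le_exp (-x)]

lemma osc_exp_upper (x : ℝ) (hx : 0 ≤ x) : Real.exp (-x) - 1 + x - x ^ 2 / 2 ≤ 0 := by
  have h := Real.quadratic_le_exp_of_nonneg hx
  have h1 : Real.exp (-x) * Real.exp x = 1 := by rw [← Real.exp_add]; simp
  have h0 := Real.exp_pos (-x)
  have h2 : Real.exp (-x) * (1 + x + x ^ 2 / 2) ≤ 1 := by
    exact (mul_le_mul_of_nonneg_left h h0.le).trans h1.le
  by_contra hn
  push Not at hn
  have : (1 - x + x ^ 2 / 2) * (1 + x + x ^ 2 / 2) < Real.exp (-x) * (1 + x + x ^ 2 / 2) := by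
    apply mul_lt_mul_of_pos_right
    · linarith
    · positivity
  nlinarith [sq_nonneg (x ^ 2)]

lemma osc_exp_cubic (x : ℝ) (hx : 0 ≤ x) : -x ^ 3 ≤ Real.exp (-x) - 1 + x - x ^ 2 / 2 := by
  rcases le_total x 1 with h | h
  · have := Real.exp_bound (x := -x) (by rwa [abs_neg, abs_of_nonneg hx]) (n := 3) (by norm_num)
    rw [abs_neg, abs_of_nonneg hx] at this
    have := (abs_le.mp this).1
    norm_num [Finset.sum_range_succ, Nat.factorial] at this
    nlinarith [pow_nonneg hx 3]
  · have := osc_exp_lower x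
    nlinarith [sq_nonneg x, mul_le_mul_of_nonneg_left h (sq_nonneg x)]

theorem stmt13 (a b : ℝ) (ha0 : 0 < a) (ha1 : a < 1) (hb : 0 < b)
    (H s t : ℝ) (hs : 0 ≤ s) (ht : 0 ≤ t) :
    (1 / 2 < H → H < 1 →
      (∑' j : ℤ, (b * a ^ j) ^ (1 - 2 * H) *
        ∫ r in (0:ℝ)..(min s t),
          (1 - Real.exp (-(b * a ^ j * (t - r)))) * (1 - Real.exp (-(b * a ^ j * (s - r)))))
      = Qcov a b H s t) ∧
    (1 < H → H < 3 / 2 →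
      (∑' j : ℤ, (b * a ^ j) ^ (1 - 2 * H) *
        ∫ r in (0:ℝ)..(min s t),
          (1 - Real.exp (-(b * a ^ j * (t - r)))) * (1 - Real.exp (-(b * a ^ j * (s - r)))))
      = Qtil a b H s t) := by
  constructor
  · intro h1 h2
    have h0 : ∀ x : ℝ, 0 ≤ x → |Real.exp (-x) - 1 + x| ≤ x ^ 1 := fun x hx => by
      rw [abs_of_nonneg (osc_exp_lower x)]
      have : Real.exp (-x) ≤ 1 := Real.exp_le_one_iff.mpr (by linarith)
      linarith
    have h0' : ∀ x : ℝ, 0 ≤ x → |Real.exp (-x) - 1 + x| ≤ x ^ (1 + 1) := fun x hx => by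
      rw [abs_of_nonneg (osc_exp_lower x)]
      norm_num
      linarith [osc_exp_upper x hx, sq_nonneg x]
    exact osc_main a b ha0 ha1 hb H 1 one_pos (by push_cast; linarith) (by push_cast; linarith)
      (fun x => Real.exp (-x) - 1 + x) h0 h0' 0 (fun x => by ring) (hosc a b H)
      (fun t => rfl) s t hs ht
  · intro h1 h2
    have h0 : ∀ x : ℝ, 0 ≤ x → |Real.exp (-x) - 1 + x - x ^ 2 / 2| ≤ x ^ 2 := fun x hx => by
      rw [abs_of_nonpos (osc_exp_upper x hx)]
      nlinarith [osc_exp_lower x]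
    have h0' : ∀ x : ℝ, 0 ≤ x → |Real.exp (-x) - 1 + x - x ^ 2 / 2| ≤ x ^ (2 + 1) :=
      fun x hx => by
      rw [abs_of_nonpos (osc_exp_upper x hx)]
      linarith [osc_exp_cubic x hx]
    exact osc_main a b ha0 ha1 hb H 2 two_pos (by push_cast; linarith) (by push_cast; linarith)
      (fun x => Real.exp (-x) - 1 + x - x ^ 2 / 2) h0 h0' (1 / 2) (fun x => by ring)
      (htil a b H) (fun t => rfl) s t hs ht
end

section
/- Let U be in (0, 1/2). Then for every t > 0 the series ĥ_t^U = Σ_{j∈ℤ} (b a^j t)^{-2U} (1 - e^{-b a^j t}) converges and there exist constants 0 < C₁ ≤ C₂ < ∞ such that C₁ ≤ ĥ_t^U ≤ C₂ for all t > 0. Moreover, with H = U + 1 in (1, 3/2), for all s, t ≥ 0: ∫_0^t ∫_0^s (1/2)[(u+v)^{2U} ĥ_{u+v}^U - |u-v|^{2U} ĥ_{|u-v|}^U] du dv = Q̃_H(s,t). (This is the analytic content of the representation of onsfBm as the time integral of the Gaussian process ϱ^U with covariance (1/2)[(s+t)^{2U} ĥ_{s+t}^U - |s-t|^{2U} ĥ_{|s-t|}^U].)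 -/
open Real MeasureTheory

/-- The oscillatory function `ĥ_t^U = Σ_{j∈ℤ} (b a^j t)^{-2U} (1 - e^{-b a^j t})`. -/
noncomputable def hhat (a b U t : ℝ) : ℝ :=
  ∑' j : ℤ, (b * a ^ j * t) ^ (-(2 * U)) * (1 - Real.exp (-(b * a ^ j * t)))

/-- summand of `t ^ (2U) * hhat t`, evenly extended -/
noncomputable def kk (U c x : ℝ) : ℝ := c ^ (-(2 * U)) * (1 - Real.exp (-(c * |x|)))

/-- its sum -/
noncomputable def gg (a b U x : ℝ) : ℝ := ∑' j : ℤ, kk U (b * a ^ j) x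

/-- dominating term -/
noncomputable def mm (U R c : ℝ) : ℝ := c ^ (-(2 * U)) * min 1 (c * R)

lemma kk_nonneg (U c x : ℝ) (hc : 0 < c) : 0 ≤ kk U c x := by
  unfold kk
  have h : Real.exp (-(c * |x|)) ≤ 1 := by
    rw [Real.exp_le_one_iff]; have := mul_nonneg hc.le (abs_nonneg x); linarith
  exact mul_nonneg (Real.rpow_nonneg hc.le _) (by linarith)

lemma kk_le (U c x R : ℝ) (hc : 0 < c) (hx : |x| ≤ R) : kk U c x ≤ mm U R c := by
  unfold kk mm
  refine mul_le_mul_of_nonneg_left (le_min ?_ ?_) (Real.rpow_nonneg hc.le _)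
  · have := Real.exp_pos (-(c * |x|)); linarith
  · have := Real.add_one_le_exp (-(c * |x|))
    have := mul_le_mul_of_nonneg_left hx hc.le
    linarith

lemma norm_kk_le (U c x R : ℝ) (hc : 0 < c) (hx : |x| ≤ R) : ‖kk U c x‖ ≤ mm U R c := by
  rw [Real.norm_of_nonneg (kk_nonneg U c x hc)]; exact kk_le U c x R hc hx

lemma kk_cont (U c : ℝ) : Continuous (kk U c) := by
  unfold kk; fun_prop

lemma mm_summable (a b : ℝ) (ha0 : 0 < a) (ha1 : a < 1) (hb : 0 < b)
    (U : ℝ) (hU1 : 0 < U) (hU2 : U < 1 / 2) (R : ℝ) (hR : 0 ≤ R) :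
    Summable (fun j : ℤ => mm U R (b * a ^ j)) := by
  have hc : ∀ j : ℤ, 0 < b * a ^ j := fun j => by positivity
  have hnn : ∀ j : ℤ, 0 ≤ mm U R (b * a ^ j) := fun j => by
    have := hc j
    unfold mm; positivity
  apply Summable.of_nat_of_neg
  · have hr : a ^ (1 - 2 * U) < 1 := Real.rpow_lt_one ha0.le ha1 (by linarith)
    have hs := (summable_geometric_of_lt_one (Real.rpow_nonneg ha0.le (1 - 2 * U)) hr).mul_left
      (b ^ (1 - 2 * U) * R)
    refine Summable.of_nonneg_of_le (fun n => hnn n) (fun n => ?_) hs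
    have h1 : mm U R (b * a ^ (n : ℤ)) ≤ (b * a ^ (n : ℤ)) ^ (-(2 * U)) * ((b * a ^ (n : ℤ)) * R) :=
      mul_le_mul_of_nonneg_left (min_le_right _ _) (Real.rpow_nonneg (hc n).le _)
    refine h1.trans (le_of_eq ?_)
    rw [← mul_assoc, ← Real.rpow_add_one (hc n).ne', show -(2 * U) + 1 = 1 - 2 * U by ring,
      Real.mul_rpow hb.le (by positivity), zpow_natCast, ← Real.rpow_natCast, ← Real.rpow_natCast,
      ← Real.rpow_mul ha0.le, ← Real.rpow_mul ha0.le, mul_comm (n : ℝ)]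
    ring
  · have hr : a ^ (2 * U) < 1 := Real.rpow_lt_one ha0.le ha1 (by linarith)
    have hs := (summable_geometric_of_lt_one (Real.rpow_nonneg ha0.le (2 * U)) hr).mul_left
      (b ^ (-(2 * U)))
    refine Summable.of_nonneg_of_le (fun n => hnn _) (fun n => ?_) hs
    have h1 : mm U R (b * a ^ (-(n : ℤ))) ≤ (b * a ^ (-(n : ℤ))) ^ (-(2 * U)) * 1 :=
      mul_le_mul_of_nonneg_left (min_le_left _ _) (Real.rpow_nonneg (hc _).le _)
    refine h1.trans (le_of_eq ?_)
    rw [mul_one, Real.mul_rpow hb.le (by positivity), zpow_neg, zpow_natCast, ← Real.rpow_natCast,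
      ← Real.rpow_natCast, ← Real.rpow_neg ha0.le,
      ← Real.rpow_mul ha0.le, ← Real.rpow_mul ha0.le]
    congr 2
    ring

lemma kk_summable (a b : ℝ) (ha0 : 0 < a) (ha1 : a < 1) (hb : 0 < b)
    (U : ℝ) (hU1 : 0 < U) (hU2 : U < 1 / 2) (x : ℝ) :
    Summable (fun j : ℤ => kk U (b * a ^ j) x) :=
  Summable.of_nonneg_of_le (fun j => kk_nonneg _ _ _ (by positivity))
    (fun j => kk_le U _ x |x| (by positivity) le_rfl)
    (mm_summable a b ha0 ha1 hb U hU1 hU2 |x| (abs_nonneg x))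

lemma gg_cont (a b : ℝ) (ha0 : 0 < a) (ha1 : a < 1) (hb : 0 < b)
    (U : ℝ) (hU1 : 0 < U) (hU2 : U < 1 / 2) : Continuous (gg a b U) := by
  rw [continuous_iff_continuousAt]
  intro x
  have h : ContinuousOn (gg a b U) (Set.Icc (-(|x| + 1)) (|x| + 1)) :=
    continuousOn_tsum (fun j => (kk_cont U _).continuousOn)
      (mm_summable a b ha0 ha1 hb U hU1 hU2 (|x| + 1) (by positivity))
      (fun j y hy => norm_kk_le U _ y _ (by positivity) (abs_le.2 hy))
  refine h.continuousAt (Icc_mem_nhds ?_ ?_)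
  · have := neg_abs_le x; linarith
  · have := le_abs_self x; linarith

lemma gg_neg (a b U x : ℝ) : gg a b U (-x) = gg a b U x := by
  simp [gg, kk]

lemma gg_pos (a b : ℝ) (ha0 : 0 < a) (ha1 : a < 1) (hb : 0 < b)
    (U : ℝ) (hU1 : 0 < U) (hU2 : U < 1 / 2) (x : ℝ) (hx : 0 < x) : 0 < gg a b U x := by
  refine (kk_summable a b ha0 ha1 hb U hU1 hU2 x).tsum_pos
    (fun j => kk_nonneg _ _ _ (by positivity)) 0 ?_
  unfold kk
  have h0 : 0 < b * a ^ (0 : ℤ) := by positivity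
  have : Real.exp (-(b * a ^ (0 : ℤ) * |x|)) < 1 := by
    rw [Real.exp_lt_one_iff]
    have := mul_pos h0 (abs_pos.2 hx.ne'); linarith
  exact mul_pos (Real.rpow_pos_of_pos h0 _) (by linarith)

lemma term_eq (U c t : ℝ) (hc : 0 < c) (ht : 0 < t) :
    (c * t) ^ (-(2 * U)) * (1 - Real.exp (-(c * t))) = t ^ (-(2 * U)) * kk U c t := by
  unfold kk
  rw [abs_of_pos ht, Real.mul_rpow hc.le ht.le]; ring

lemma hhat_eq (a b : ℝ) (ha0 : 0 < a) (hb : 0 < b) (U t : ℝ) (ht : 0 < t) :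
    hhat a b U t = t ^ (-(2 * U)) * gg a b U t := by
  unfold hhat gg
  rw [← tsum_mul_left]
  exact tsum_congr fun j => term_eq U _ t (by positivity) ht

lemma rpow_hhat (a b : ℝ) (ha0 : 0 < a) (hb : 0 < b) (U t : ℝ) (hU : 0 < U) (ht : 0 ≤ t) :
    t ^ (2 * U) * hhat a b U t = gg a b U t := by
  rcases ht.eq_or_lt with rfl | ht
  · rw [Real.zero_rpow (by positivity)]; simp [gg, kk]
  · rw [hhat_eq a b ha0 hb U t ht, ← mul_assoc, ← Real.rpow_add ht]; simp

lemma hhat_scale (a b : ℝ) (ha0 : 0 < a) (U t : ℝ) (n : ℤ) :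
    hhat a b U (a ^ n * t) = hhat a b U t := by
  unfold hhat
  rw [← (Equiv.addRight n).tsum_eq (fun j : ℤ =>
    (b * a ^ j * t) ^ (-(2 * U)) * (1 - Real.exp (-(b * a ^ j * t))))]
  refine tsum_congr fun j => ?_
  have : b * a ^ j * (a ^ n * t) = b * a ^ ((Equiv.addRight n) j) * t := by
    simp only [Equiv.coe_addRight]
    rw [zpow_add₀ ha0.ne']; ring
  rw [this]

/-- exchange of sum and integral -/
lemma swap (F : ℤ → ℝ → ℝ) (f : ℝ → ℝ) (u : ℤ → ℝ) (x : ℝ)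
    (hF : ∀ j, Continuous (F j)) (hu : Summable u)
    (hb : ∀ j, ∀ r ∈ Set.uIoc 0 x, ‖F j r‖ ≤ u j)
    (hs : ∀ r ∈ Set.uIoc 0 x, HasSum (fun j => F j r) (f r)) :
    HasSum (fun j => ∫ r in (0:ℝ)..x, F j r) (∫ r in (0:ℝ)..x, f r) := by
  refine intervalIntegral.hasSum_integral_of_dominated_convergence (fun j _ => u j)
    (fun j => (hF j).aestronglyMeasurable) (fun j => ?_) ?_ ?_ ?_
  · exact Filter.Eventually.of_forall fun r hr => hb j r hr
  · exact Filter.Eventually.of_forall fun r hr => hu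
  · exact intervalIntegrable_const
  · exact Filter.Eventually.of_forall fun r hr => hs r hr

lemma int_kk (U c y : ℝ) (hc : 0 < c) (hy : 0 ≤ y) :
    ∫ r in (0:ℝ)..y, kk U c r = c ^ (-(2 * U)) * (y + Real.exp (-(c * y)) / c - 1 / c) := by
  have h1 : ∫ r in (0:ℝ)..y, kk U c r
      = ∫ r in (0:ℝ)..y, c ^ (-(2 * U)) * (1 - Real.exp (-(c * r))) := by
    refine intervalIntegral.integral_congr fun r hr => ?_
    rw [Set.uIcc_of_le hy] at hr
    simp only [kk, abs_of_nonneg hr.1]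
  rw [h1, intervalIntegral.integral_eq_sub_of_hasDerivAt
    (f := fun r => c ^ (-(2 * U)) * (r + Real.exp (-(c * r)) / c))]
  · simp; ring
  · intro r _
    have h2 : HasDerivAt (fun r : ℝ => -(c * r)) (-(c * 1)) r :=
      ((hasDerivAt_id r).const_mul c).neg
    have h3 := (((hasDerivAt_id r).add (h2.exp.div_const c))).const_mul (c ^ (-(2 * U)))
    refine HasDerivAt.congr_deriv h3 ?_
    field_simp
    ring
  · exact (by fun_prop : Continuous _).intervalIntegrable _ _

lemma int_int_kk (U c x : ℝ) (hc : 0 < c) (hx : 0 ≤ x) :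
    ∫ y in (0:ℝ)..x, ∫ r in (0:ℝ)..y, kk U c r
      = c ^ (-(2 * U)) * (x ^ 2 / 2 - Real.exp (-(c * x)) / c ^ 2 - x / c + 1 / c ^ 2) := by
  have h1 : ∫ y in (0:ℝ)..x, ∫ r in (0:ℝ)..y, kk U c r
      = ∫ y in (0:ℝ)..x, c ^ (-(2 * U)) * (y + Real.exp (-(c * y)) / c - 1 / c) := by
    refine intervalIntegral.integral_congr fun r hr => ?_
    rw [Set.uIcc_of_le hx] at hr
    exact int_kk U c r hc hr.1
  rw [h1, intervalIntegral.integral_eq_sub_of_hasDerivAt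
    (f := fun r => c ^ (-(2 * U)) * (r ^ 2 / 2 - Real.exp (-(c * r)) / c ^ 2 - r / c))]
  · simp; ring
  · intro r _
    have h2 : HasDerivAt (fun r : ℝ => -(c * r)) (-(c * 1)) r :=
      ((hasDerivAt_id r).const_mul c).neg
    have h3 := (((((hasDerivAt_id r).pow 2).div_const 2).sub (h2.exp.div_const (c ^ 2))).sub
      ((hasDerivAt_id r).div_const c)).const_mul (c ^ (-(2 * U)))
    refine HasDerivAt.congr_deriv h3 ?_
    congr 1
    simp
    field_simp
    try ring
  · exact (by fun_prop : Continuous _).intervalIntegrable _ _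

/-- the double primitive -/
noncomputable def PP (a b U x : ℝ) : ℝ := ∫ y in (0:ℝ)..x, ∫ r in (0:ℝ)..y, gg a b U r

lemma PP_eq (a b : ℝ) (ha0 : 0 < a) (ha1 : a < 1) (hb : 0 < b)
    (U : ℝ) (hU1 : 0 < U) (hU2 : U < 1 / 2) (x : ℝ) (hx : 0 ≤ x) :
    x ^ (2 * (U + 1)) * htil a b (U + 1) x = - PP a b U x := by
  have hm := mm_summable a b ha0 ha1 hb U hU1 hU2 x hx
  have hc : ∀ j : ℤ, 0 < b * a ^ j := fun j => by positivity
  have hkb : ∀ j : ℤ, ∀ y ∈ Set.uIoc 0 x, ∀ r ∈ Set.uIoc 0 y,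
      ‖kk U (b * a ^ j) r‖ ≤ mm U x (b * a ^ j) := by
    intro j y hy r hr
    rw [Set.uIoc_of_le hx] at hy
    rw [Set.uIoc_of_le hy.1.le] at hr
    exact norm_kk_le U _ r x (hc j) (by rw [abs_of_pos hr.1]; exact hr.2.trans hy.2)
  have h1 : ∀ y ∈ Set.uIoc 0 x, HasSum (fun j : ℤ => ∫ r in (0:ℝ)..y, kk U (b * a ^ j) r)
      (∫ r in (0:ℝ)..y, gg a b U r) := fun y hy =>
    swap _ _ _ y (fun j => kk_cont U _) hm (fun j => hkb j y hy)
      (fun r _ => (kk_summable a b ha0 ha1 hb U hU1 hU2 r).hasSum)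
  have h2 : HasSum (fun j : ℤ => ∫ y in (0:ℝ)..x, ∫ r in (0:ℝ)..y, kk U (b * a ^ j) r)
      (PP a b U x) := by
    refine swap _ _ (fun j : ℤ => mm U x (b * a ^ j) * x) x (fun j => ?_) (hm.mul_right x) ?_ h1
    · exact intervalIntegral.continuous_primitive
        (fun p q => (kk_cont U _).intervalIntegrable p q) 0
    · intro j y hy
      refine (intervalIntegral.norm_integral_le_of_norm_le_const (hkb j y hy)).trans ?_
      have hm0 : 0 ≤ mm U x (b * a ^ j) := by
        have := hc j
        unfold mm; positivity
      rw [Set.uIoc_of_le hx] at hy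
      refine mul_le_mul_of_nonneg_left ?_ hm0
      rw [sub_zero, abs_of_pos hy.1]; exact hy.2
  rcases hx.eq_or_lt with rfl | hx0
  · rw [Real.zero_rpow (by positivity)]; simp [PP]
  · rw [← h2.tsum_eq, htil, ← tsum_mul_left, ← tsum_neg]
    refine tsum_congr fun j => ?_
    rw [int_int_kk U _ x (hc j) hx]
    have hcj := hc j
    generalize b * a ^ j = c at hcj
    have e1 : x ^ (2 * (U + 1)) * (c * x) ^ (-(2 * (U + 1))) = c ^ (-(2 * U)) / c ^ 2 := by
      rw [Real.mul_rpow hcj.le hx, mul_left_comm, ← Real.rpow_add hx0, add_neg_cancel,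
        Real.rpow_zero, mul_one, show -(2 * (U + 1)) = -(2 * U) - (2 : ℕ) by push_cast; ring,
        Real.rpow_sub_natCast hcj.ne']
    rw [← mul_assoc, e1]
    field_simp
    ring

/-- abstract double-integral identity -/
lemma dbl (g : ℝ → ℝ) (hg : Continuous g) (hev : ∀ x, g (-x) = g x) (P : ℝ → ℝ)
    (hP : ∀ x, P x = ∫ y in (0:ℝ)..x, ∫ r in (0:ℝ)..y, g r) (s t : ℝ) :
    ∫ v in (0:ℝ)..t, ∫ u in (0:ℝ)..s, (1 / 2) * (g (u + v) - g (u - v))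
      = (1 / 2) * (P (s + t) + P |s - t|) - P s - P t := by
  have hi : ∀ p q, IntervalIntegrable g volume p q := fun p q => hg.intervalIntegrable p q
  obtain ⟨φ, hφ⟩ : ∃ φ : ℝ → ℝ, ∀ y, φ y = ∫ r in (0:ℝ)..y, g r := ⟨_, fun _ => rfl⟩
  have hφc : Continuous φ := by
    rw [show φ = _ from funext hφ]; exact intervalIntegral.continuous_primitive hi 0
  have hφi : ∀ p q, IntervalIntegrable φ volume p q := fun p q => hφc.intervalIntegrable p q
  have hφs : ∀ p q, ∫ r in p..q, g r = φ q - φ p := fun p q => by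
    rw [hφ, hφ, intervalIntegral.integral_interval_sub_left (hi _ _) (hi _ _)]
  have hP' : ∀ x, P x = ∫ y in (0:ℝ)..x, φ y := fun x => by simp only [hP, hφ]
  have hPs : ∀ p q, ∫ r in p..q, φ r = P q - P p := fun p q => by
    rw [hP', hP', intervalIntegral.integral_interval_sub_left (hφi _ _) (hφi _ _)]
  have hodd : ∀ x, φ (-x) = - φ x := fun x => by
    have h := intervalIntegral.integral_comp_neg (a := 0) (b := x) g
    simp only [hev, neg_zero] at h
    rw [hφ, hφ, h, intervalIntegral.integral_symm]
  have hPe : ∀ x, P (-x) = P x := fun x => by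
    have h := intervalIntegral.integral_comp_neg (a := 0) (b := x) φ
    simp only [hodd, neg_zero, intervalIntegral.integral_neg] at h
    rw [hP', hP', intervalIntegral.integral_symm, ← h, neg_neg]
  have hPabs : ∀ x, P |x| = P x := fun x => by
    rcases abs_choice x with h | h <;> rw [h]
    exact hPe x
  have hP0 : P 0 = 0 := by rw [hP']; simp
  have hin : ∀ v, ∫ u in (0:ℝ)..s, (1 / 2) * (g (u + v) - g (u - v))
      = (1 / 2) * ((φ (v + s) - φ v) - (φ (s - v) + φ v)) := fun v => by
    rw [intervalIntegral.integral_const_mul, intervalIntegral.integral_sub,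
      intervalIntegral.integral_comp_add_right, intervalIntegral.integral_comp_sub_right,
      hφs, hφs, zero_add, zero_sub, hodd, sub_neg_eq_add, add_comm s v]
    · exact (hg.comp (by fun_prop)).intervalIntegrable _ _
    · exact (hg.comp (by fun_prop)).intervalIntegrable _ _
  simp only [hin]
  have c1 : IntervalIntegrable (fun v => φ (v + s)) volume 0 t :=
    (hφc.comp (by fun_prop)).intervalIntegrable _ _
  have c2 : IntervalIntegrable (fun v => φ (s - v)) volume 0 t :=
    (hφc.comp (by fun_prop)).intervalIntegrable _ _
  rw [intervalIntegral.integral_const_mul,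
    intervalIntegral.integral_sub (c1.sub (hφi _ _)) (c2.add (hφi _ _)),
    intervalIntegral.integral_sub c1 (hφi _ _), intervalIntegral.integral_add c2 (hφi _ _),
    intervalIntegral.integral_comp_add_right, intervalIntegral.integral_comp_sub_left,
    hPs, hPs, hPs, hPabs, zero_add, sub_zero, hP0, add_comm t s]
  ring

theorem stmt14 (a b : ℝ) (ha0 : 0 < a) (ha1 : a < 1) (hb : 0 < b)
    (U : ℝ) (hU1 : 0 < U) (hU2 : U < 1 / 2) :
    (∀ t : ℝ, 0 < t →
      Summable (fun j : ℤ =>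
        (b * a ^ j * t) ^ (-(2 * U)) * (1 - Real.exp (-(b * a ^ j * t))))) ∧
    (∃ C₁ C₂ : ℝ, 0 < C₁ ∧ C₁ ≤ C₂ ∧
      ∀ t : ℝ, 0 < t → C₁ ≤ hhat a b U t ∧ hhat a b U t ≤ C₂) ∧
    (∀ s t : ℝ, 0 ≤ s → 0 ≤ t →
      (∫ v in (0:ℝ)..t, ∫ u in (0:ℝ)..s,
        (1 / 2) * ((u + v) ^ (2 * U) * hhat a b U (u + v)
          - |u - v| ^ (2 * U) * hhat a b U |u - v|))
      = Qtil a b (U + 1) s t) := by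
  refine ⟨fun t ht => ?_, ?_, fun s t hs ht => ?_⟩
  · refine ((kk_summable a b ha0 ha1 hb U hU1 hU2 t).mul_left (t ^ (-(2 * U)))).congr fun j => ?_
    exact (term_eq U _ t (by positivity) ht).symm
  · have hco : ContinuousOn (fun t => t ^ (-(2 * U)) * gg a b U t) (Set.Icc 1 a⁻¹) := by
      refine ContinuousOn.mul (fun x hx => ?_) (gg_cont a b ha0 ha1 hb U hU1 hU2).continuousOn
      have hx0 : x ≠ 0 := (lt_of_lt_of_le one_pos hx.1).ne'
      exact (Real.continuousAt_rpow_const x _ (Or.inl hx0)).continuousWithinAt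
    have ha' : 1 < a⁻¹ := (one_lt_inv₀ ha0).2 ha1
    have hne : (Set.Icc 1 a⁻¹).Nonempty := ⟨1, le_rfl, ha'.le⟩
    obtain ⟨p, hp, hpm⟩ := isCompact_Icc.exists_isMinOn hne hco
    obtain ⟨q, hq, hqm⟩ := isCompact_Icc.exists_isMaxOn hne hco
    have hp0 : 0 < p := lt_of_lt_of_le one_pos hp.1
    refine ⟨_, _, ?_, hpm hq, fun t ht => ?_⟩
    · exact mul_pos (Real.rpow_pos_of_pos hp0 _) (gg_pos a b ha0 ha1 hb U hU1 hU2 p hp0)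
    · obtain ⟨n, hn1, hn2⟩ := exists_mem_Ico_zpow ht ha'
      have han : 0 < a ^ n := zpow_pos ha0 n
      have hτ : a ^ n * t ∈ Set.Icc 1 a⁻¹ := by
        rw [inv_zpow] at hn1
        rw [zpow_add_one₀ (by positivity), inv_zpow] at hn2
        constructor
        · rw [inv_le_iff_one_le_mul₀ han] at hn1; linarith
        · have := mul_le_mul_of_nonneg_left hn2.le han.le
          rwa [mul_inv_cancel_left₀ han.ne'] at this
      have e : hhat a b U t = _ := (hhat_scale a b ha0 U t n).symm.trans
        (hhat_eq a b ha0 hb U _ (by positivity))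
      rw [e]
      exact ⟨hpm hτ, hqm hτ⟩
  · have h1 : (∫ v in (0:ℝ)..t, ∫ u in (0:ℝ)..s,
        (1 / 2) * ((u + v) ^ (2 * U) * hhat a b U (u + v)
          - |u - v| ^ (2 * U) * hhat a b U |u - v|))
        = ∫ v in (0:ℝ)..t, ∫ u in (0:ℝ)..s,
          (1 / 2) * (gg a b U (u + v) - gg a b U (u - v)) := by
      refine intervalIntegral.integral_congr fun v hv => ?_
      refine intervalIntegral.integral_congr fun u hu => ?_
      rw [Set.uIcc_of_le ht] at hv
      rw [Set.uIcc_of_le hs] at hu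
      have h3 : gg a b U |u - v| = gg a b U (u - v) := by simp [gg, kk]
      rw [rpow_hhat a b ha0 hb U _ hU1 (add_nonneg hu.1 hv.1),
        rpow_hhat a b ha0 hb U _ hU1 (abs_nonneg _), h3]
    rw [h1, dbl (gg a b U) (gg_cont a b ha0 ha1 hb U hU1 hU2) (gg_neg a b U) (PP a b U)
      (fun _ => rfl), Qtil, PP_eq a b ha0 ha1 hb U hU1 hU2 s hs,
      PP_eq a b ha0 ha1 hb U hU1 hU2 t ht, PP_eq a b ha0 ha1 hb U hU1 hU2 _ (add_nonneg hs ht),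
      PP_eq a b ha0 ha1 hb U hU1 hU2 _ (abs_nonneg _)]
    ring
end

section
/- Let H be in (1/2, 1) ∪ (1, 3/2) and fix 0 ≤ u < v ≤ s < t. Define g(τ) = P(v, t+τ) - P(v, s+τ) - P(u, t+τ) + P(u, s+τ), where P = Q_H if H is in (1/2, 1) and P = Q̃_H if H is in (1, 3/2) (the covariance of increments of osfBm, resp. onsfBm). Then 0 < liminf_{τ→∞} τ^{3-2H} g(τ) ≤ limsup_{τ→∞} τ^{3-2H} g(τ) < ∞. -/
open Real Filter

/-- The covariance of increments for a centered Gaussian process with covariance `P`. -/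
noncomputable def incCov (P : ℝ → ℝ → ℝ) (u v s t τ : ℝ) : ℝ :=
  P v (t + τ) - P v (s + τ) - P u (t + τ) + P u (s + τ)

lemma aux_summable (a κ p q C : ℝ) (ha0 : 0 < a) (ha1 : a < 1) (hκ : 0 < κ) (hp : 0 < p)
    (hq : 0 < q) (F : ℝ → ℝ) (h1 : ∀ y, 0 < y → |F y| ≤ C * y ^ p)
    (h2 : ∀ y, 0 < y → |F y| ≤ C * y ^ (-q)) :
    Summable (fun j : ℤ => F (κ * a ^ j)) := by
  apply Summable.of_nat_of_neg
  · apply Summable.of_norm_bounded (g := fun n : ℕ => C * κ ^ p * (a ^ p) ^ n)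
    · apply Summable.mul_left
      exact summable_geometric_of_lt_one (by positivity) (Real.rpow_lt_one ha0.le ha1 hp)
    · intro n
      rw [Real.norm_eq_abs]
      refine (h1 _ (by positivity)).trans (le_of_eq ?_)
      rw [Real.mul_rpow hκ.le (by positivity), zpow_natCast, ← Real.rpow_natCast,
        ← Real.rpow_mul ha0.le, mul_comm (n : ℝ) p, Real.rpow_mul ha0.le, Real.rpow_natCast]
      ring
  · apply Summable.of_norm_bounded (g := fun n : ℕ => C * κ ^ (-q) * (a ^ q) ^ n)
    · apply Summable.mul_left
      exact summable_geometric_of_lt_one (by positivity) (Real.rpow_lt_one ha0.le ha1 hq)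
    · intro n
      rw [Real.norm_eq_abs]
      refine (h2 _ (by positivity)).trans (le_of_eq ?_)
      rw [Real.mul_rpow hκ.le (by positivity), zpow_neg, zpow_natCast, ← Real.rpow_natCast,
        ← Real.rpow_neg ha0.le,
        ← Real.rpow_mul ha0.le, neg_mul_neg, mul_comm (n : ℝ) q, Real.rpow_mul ha0.le,
        Real.rpow_natCast]
      ring

/-- generic kernel -/
noncomputable def phiK (k y : ℝ) : ℝ := Real.exp (-y) - 1 + y - k * y ^ 2

lemma aux_F (a b H k p q C : ℝ) (ha0 : 0 < a) (ha1 : a < 1) (hb : 0 < b) (hH : 0 < H)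
    (hp : 0 < p) (hq : 0 < q)
    (h1 : ∀ y, 0 < y → |y ^ (-(2 * H)) * phiK k y| ≤ C * y ^ p)
    (h2 : ∀ y, 0 < y → |y ^ (-(2 * H)) * phiK k y| ≤ C * y ^ (-q)) (x : ℝ) (hx : 0 ≤ x) :
    HasSum (fun j : ℤ => (b * a ^ j) ^ (-(2 * H)) * phiK k (b * a ^ j * x))
      (x ^ (2 * H) * ∑' j : ℤ, (b * a ^ j * x) ^ (-(2 * H)) * phiK k (b * a ^ j * x)) := by
  rcases hx.eq_or_lt with rfl | hx
  · rw [Real.zero_rpow (by positivity)]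
    simp [phiK]
  · have := aux_summable a (b * x) p q C ha0 ha1 (by positivity) hp hq _ h1 h2
    have h3 := this.hasSum.mul_left (x ^ (2 * H))
    have e : ∀ j : ℤ, b * x * a ^ j = b * a ^ j * x := fun j => by ring
    simp only [e] at h3
    convert h3 using 1
    · rfl
    funext j
    have hc : 0 < b * a ^ j := by positivity
    rw [Real.mul_rpow hc.le hx.le, Real.rpow_neg hx.le]
    have : x ^ (2 * H) ≠ 0 := by positivity
    field_simp

/-- generic covariance -/
noncomputable def Qgen (a b H k s t : ℝ) : ℝ :=
  let h := fun x : ℝ => ∑' j : ℤ, (b * a ^ j * x) ^ (-(2 * H)) * phiK k (b * a ^ j * x)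
  s ^ (2 * H) * h s + t ^ (2 * H) * h t
    - (1 / 2) * ((s + t) ^ (2 * H) * h (s + t) + |s - t| ^ (2 * H) * h |s - t|)

lemma aux_inc (a b H k p q C : ℝ) (ha0 : 0 < a) (ha1 : a < 1) (hb : 0 < b) (hH : 0 < H)
    (hp : 0 < p) (hq : 0 < q)
    (h1 : ∀ y, 0 < y → |y ^ (-(2 * H)) * phiK k y| ≤ C * y ^ p)
    (h2 : ∀ y, 0 < y → |y ^ (-(2 * H)) * phiK k y| ≤ C * y ^ (-q))
    (u v s t τ : ℝ) (hu : 0 ≤ u) (huv : u < v) (hvs : v ≤ s) (hst : s < t) (hτ : 0 < τ) :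
    HasSum (fun j : ℤ => (b * a ^ j) ^ (-(2 * H)) *
      ((Real.exp (-(b * a ^ j * (s + τ))) - Real.exp (-(b * a ^ j * (t + τ)))) *
      (Real.cosh (b * a ^ j * v) - Real.cosh (b * a ^ j * u))))
      (incCov (Qgen a b H k) u v s t τ) := by
  have K := aux_F a b H k p q C ha0 ha1 hb hH hp hq h1 h2
  have e1 : |v - (t + τ)| = t + τ - v := by rw [abs_sub_comm]; exact abs_of_nonneg (by linarith)
  have e2 : |v - (s + τ)| = s + τ - v := by rw [abs_sub_comm]; exact abs_of_nonneg (by linarith)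
  have e3 : |u - (t + τ)| = t + τ - u := by rw [abs_sub_comm]; exact abs_of_nonneg (by linarith)
  have e4 : |u - (s + τ)| = s + τ - u := by rw [abs_sub_comm]; exact abs_of_nonneg (by linarith)
  have A1 := (K (v + (t + τ)) (by linarith)).add (K (t + τ - v) (by linarith))
  have A2 := (K (v + (s + τ)) (by linarith)).add (K (s + τ - v) (by linarith))
  have A3 := (K (u + (t + τ)) (by linarith)).add (K (t + τ - u) (by linarith))
  have A4 := (K (u + (s + τ)) (by linarith)).add (K (s + τ - u) (by linarith))
  have B := (((A2.add A3).sub (A1.add A4))).mul_left (1 / 2)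
  convert B using 1
  · rfl
  · funext j
    simp only [phiK, Real.cosh_eq]
    generalize b * a ^ j = c
    have x1 : Real.exp (-(c * (v + (t + τ)))) = Real.exp (-(c * (t + τ))) * Real.exp (-(c * v)) := by
      rw [← Real.exp_add]; ring_nf
    have x2 : Real.exp (-(c * (v + (s + τ)))) = Real.exp (-(c * (s + τ))) * Real.exp (-(c * v)) := by
      rw [← Real.exp_add]; ring_nf
    have x3 : Real.exp (-(c * (u + (t + τ)))) = Real.exp (-(c * (t + τ))) * Real.exp (-(c * u)) := by
      rw [← Real.exp_add]; ring_nf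
    have x4 : Real.exp (-(c * (u + (s + τ)))) = Real.exp (-(c * (s + τ))) * Real.exp (-(c * u)) := by
      rw [← Real.exp_add]; ring_nf
    have y1 : Real.exp (-(c * (t + τ - v))) = Real.exp (-(c * (t + τ))) * Real.exp (c * v) := by
      rw [← Real.exp_add]; ring_nf
    have y2 : Real.exp (-(c * (s + τ - v))) = Real.exp (-(c * (s + τ))) * Real.exp (c * v) := by
      rw [← Real.exp_add]; ring_nf
    have y3 : Real.exp (-(c * (t + τ - u))) = Real.exp (-(c * (t + τ))) * Real.exp (c * u) := by
      rw [← Real.exp_add]; ring_nf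
    have y4 : Real.exp (-(c * (s + τ - u))) = Real.exp (-(c * (s + τ))) * Real.exp (c * u) := by
      rw [← Real.exp_add]; ring_nf
    rw [x1, x2, x3, x4, y1, y2, y3, y4]
    ring
  · simp only [incCov, Qgen, e1, e2, e3, e4]
    ring

lemma aux_sinh_le (y : ℝ) (hy : 0 ≤ y) : Real.sinh y ≤ y * Real.exp y := by
  rw [Real.sinh_eq]
  have h1 := Real.add_one_le_exp (-(2 * y))
  have h2 : Real.exp (-y) = Real.exp y * Real.exp (-(2 * y)) := by
    rw [← Real.exp_add]; ring_nf
  rw [h2]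
  nlinarith [Real.exp_pos y]

lemma aux_cosh_sub (x y : ℝ) :
    Real.cosh y - Real.cosh x = 2 * Real.sinh ((y + x) / 2) * Real.sinh ((y - x) / 2) := by
  have h1 := Real.cosh_add ((y + x) / 2) ((y - x) / 2)
  have h2 := Real.cosh_sub ((y + x) / 2) ((y - x) / 2)
  rw [show (y + x) / 2 + (y - x) / 2 = y by ring] at h1
  rw [show (y + x) / 2 - (y - x) / 2 = x by ring] at h2
  rw [h1, h2]
  ring

lemma aux_term_lower (c u v S T : ℝ) (hc : 0 < c) (hu : 0 ≤ u) (huv : u < v) (hST : S < T) :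
    c ^ 3 * ((T - S) * ((v ^ 2 - u ^ 2) / 2) * Real.exp (-(c * T))) ≤
    (Real.exp (-(c * S)) - Real.exp (-(c * T))) * (Real.cosh (c * v) - Real.cosh (c * u)) := by
  have h1 : c * (T - S) * Real.exp (-(c * T)) ≤ Real.exp (-(c * S)) - Real.exp (-(c * T)) := by
    have e : Real.exp (-(c * S)) = Real.exp (-(c * T)) * Real.exp (c * (T - S)) := by
      rw [← Real.exp_add]; ring_nf
    rw [e]
    nlinarith [Real.exp_pos (-(c * T)), Real.add_one_le_exp (c * (T - S))]
  have h2 : c ^ 2 * ((v ^ 2 - u ^ 2) / 2) ≤ Real.cosh (c * v) - Real.cosh (c * u) := by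
    rw [aux_cosh_sub]
    have p1 : (c * v + c * u) / 2 ≤ Real.sinh ((c * v + c * u) / 2) :=
      Real.self_le_sinh_iff.2 (by have := huv.le; have : 0 ≤ v := by linarith
                                  positivity)
    have p2 : (c * v - c * u) / 2 ≤ Real.sinh ((c * v - c * u) / 2) :=
      Real.self_le_sinh_iff.2 (by nlinarith)
    have q1 : 0 ≤ (c * v + c * u) / 2 := by nlinarith
    have q2 : 0 ≤ (c * v - c * u) / 2 := by nlinarith
    have := mul_le_mul p1 p2 q2 (q1.trans p1)
    nlinarith
  have h3 : 0 ≤ c ^ 2 * ((v ^ 2 - u ^ 2) / 2) := by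
    have : 0 ≤ v ^ 2 - u ^ 2 := by nlinarith
    positivity
  have h4 : 0 ≤ c * (T - S) * Real.exp (-(c * T)) := by
    have : 0 ≤ T - S := by linarith
    positivity
  have := mul_le_mul h1 h2 h3 (h4.trans h1)
  calc _ = c * (T - S) * Real.exp (-(c * T)) * (c ^ 2 * ((v ^ 2 - u ^ 2) / 2)) := by ring
    _ ≤ _ := this

lemma aux_term_upper (c u v s t τ : ℝ) (hc : 0 < c) (hu : 0 ≤ u) (huv : u < v) (hvs : v ≤ s)
    (hst : s < t) :
    (Real.exp (-(c * (s + τ))) - Real.exp (-(c * (t + τ)))) *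
      (Real.cosh (c * v) - Real.cosh (c * u)) ≤
      c ^ 3 * ((t - s) * ((v ^ 2 - u ^ 2) / 2)) * Real.exp (-(c * τ)) := by
  have h1 : Real.exp (-(c * (s + τ))) - Real.exp (-(c * (t + τ))) ≤
      c * (t - s) * Real.exp (-(c * (s + τ))) := by
    have e : Real.exp (-(c * (t + τ))) = Real.exp (-(c * (s + τ))) * Real.exp (-(c * (t - s))) := by
      rw [← Real.exp_add]; ring_nf
    rw [e]
    nlinarith [Real.exp_pos (-(c * (s + τ))), Real.add_one_le_exp (-(c * (t - s)))]
  have q1 : 0 ≤ (c * v + c * u) / 2 := by nlinarith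
  have q2 : 0 ≤ (c * v - c * u) / 2 := by nlinarith
  have h2 : Real.cosh (c * v) - Real.cosh (c * u) ≤
      c ^ 2 * ((v ^ 2 - u ^ 2) / 2) * Real.exp (c * v) := by
    rw [aux_cosh_sub]
    have p1 := aux_sinh_le _ q1
    have p2 := aux_sinh_le _ q2
    have := mul_le_mul p1 p2 (Real.sinh_nonneg_iff.2 q2) (by positivity)
    have e : Real.exp (c * v) = Real.exp ((c * v + c * u) / 2) * Real.exp ((c * v - c * u) / 2) := by
      rw [← Real.exp_add]; ring_nf
    rw [e]
    calc _ = 2 * (Real.sinh ((c * v + c * u) / 2) * Real.sinh ((c * v - c * u) / 2)) := by ring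
      _ ≤ 2 * _ := mul_le_mul_of_nonneg_left this (by norm_num)
      _ = _ := by ring
  have h3 : 0 ≤ Real.cosh (c * v) - Real.cosh (c * u) := by
    rw [aux_cosh_sub]
    have := Real.sinh_nonneg_iff.2 q1
    have := Real.sinh_nonneg_iff.2 q2
    positivity
  have hts : 0 ≤ t - s := by linarith
  have hvu : 0 ≤ v ^ 2 - u ^ 2 := by nlinarith
  have := mul_le_mul h1 h2 h3 (by positivity)
  refine this.trans ?_
  have e : Real.exp (-(c * (s + τ))) * Real.exp (c * v) ≤ Real.exp (-(c * τ)) := by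
    rw [← Real.exp_add]
    apply Real.exp_le_exp.2
    nlinarith
  calc _ = c ^ 3 * ((t - s) * ((v ^ 2 - u ^ 2) / 2)) *
        (Real.exp (-(c * (s + τ))) * Real.exp (c * v)) := by ring
    _ ≤ _ := mul_le_mul_of_nonneg_left e (by positivity)

lemma aux_index (a b τ : ℝ) (ha0 : 0 < a) (ha1 : a < 1) (hb : 0 < b) (hτ : 0 < τ) :
    ∃ n : ℤ, a ≤ b * a ^ n * τ ∧ b * a ^ n * τ ≤ 1 := by
  obtain ⟨n, h1, h2⟩ := exists_mem_Ico_zpow (x := b * τ) (y := a⁻¹) (by positivity)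
    ((one_lt_inv₀ ha0).2 ha1)
  refine ⟨n + 1, ?_, ?_⟩
  · have h : 0 < a ^ n := by positivity
    rw [inv_zpow] at h1
    have := mul_le_mul_of_nonneg_left h1 h.le
    rw [mul_inv_cancel₀ h.ne'] at this
    rw [zpow_add_one₀ ha0.ne']
    nlinarith
  · have h : 0 < a ^ (n + 1) := by positivity
    rw [inv_zpow] at h2
    have := mul_le_mul_of_nonneg_left h2.le h.le
    rw [mul_inv_cancel₀ h.ne'] at this
    nlinarith

lemma aux_main (a b H k p q C : ℝ) (ha0 : 0 < a) (ha1 : a < 1) (hb : 0 < b) (hH : 0 < H)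
    (hH2 : H < 3 / 2) (hp : 0 < p) (hq : 0 < q)
    (h1 : ∀ y, 0 < y → |y ^ (-(2 * H)) * phiK k y| ≤ C * y ^ p)
    (h2 : ∀ y, 0 < y → |y ^ (-(2 * H)) * phiK k y| ≤ C * y ^ (-q))
    (u v s t : ℝ) (hu : 0 ≤ u) (huv : u < v) (hvs : v ≤ s) (hst : s < t) :
    ∃ m M : ℝ, 0 < m ∧ ∀ τ : ℝ, 1 ≤ τ →
      m ≤ τ ^ (3 - 2 * H) * incCov (Qgen a b H k) u v s t τ ∧
      τ ^ (3 - 2 * H) * incCov (Qgen a b H k) u v s t τ ≤ M := by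
  set D : ℝ := (t - s) * ((v ^ 2 - u ^ 2) / 2) with hD
  have hDpos : 0 < D := by
    have : 0 < t - s := by linarith
    have : 0 < v ^ 2 - u ^ 2 := by nlinarith
    positivity
  have hα : 0 < 3 - 2 * H := by linarith
  have ht : 0 < t := by linarith
  -- the dominating sum
  have hS : Summable (fun j : ℤ => (1 * a ^ j) ^ (3 - 2 * H) * Real.exp (-(a * (1 * a ^ j)))) := by
    refine aux_summable a 1 (3 - 2 * H) (2 * H) (max 1 (6 / a ^ 3)) ha0 ha1 one_pos hα (by linarith)
      (fun y => y ^ (3 - 2 * H) * Real.exp (-(a * y))) ?_ ?_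
    · intro y hy
      rw [abs_of_nonneg (by positivity), mul_comm]
      apply mul_le_mul_of_nonneg_right _ (by positivity)
      refine le_trans ?_ (le_max_left _ _)
      rw [Real.exp_le_one_iff]
      have : 0 < a * y := by positivity
      linarith
    · intro y hy
      rw [abs_of_nonneg (by positivity)]
      have e : y ^ (3 - 2 * H) = y ^ (-(2 * H)) * y ^ 3 := by
        rw [← Real.rpow_natCast, ← Real.rpow_add hy]; congr 1; push_cast; ring
      rw [e]
      have : y ^ 3 * Real.exp (-(a * y)) ≤ 6 / a ^ 3 := by
        have h := Real.pow_div_factorial_le_exp (a * y) (by positivity) 3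
        rw [Real.exp_neg, ← div_eq_mul_inv, div_le_div_iff₀ (Real.exp_pos _) (by positivity)]
        norm_num [Nat.factorial] at h
        nlinarith
      calc _ = (y ^ 3 * Real.exp (-(a * y))) * y ^ (-(2 * H)) := by ring
        _ ≤ _ := mul_le_mul_of_nonneg_right (this.trans (le_max_right _ _)) (by positivity)
  refine ⟨a ^ (3 - 2 * H) * (D * Real.exp (-(1 + t))),
    D * ∑' j : ℤ, (1 * a ^ j) ^ (3 - 2 * H) * Real.exp (-(a * (1 * a ^ j))),
    by positivity, fun τ hτ => ?_⟩
  have hτ0 : 0 < τ := by linarith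
  have hsum := aux_inc a b H k p q C ha0 ha1 hb hH hp hq h1 h2 u v s t τ hu huv hvs hst hτ0
  obtain ⟨n, hn1, hn2⟩ := aux_index a b τ ha0 ha1 hb hτ0
  have hsum2 := hsum.mul_left (τ ^ (3 - 2 * H))
  have hcr : ∀ c : ℝ, 0 < c → c ^ (-(2 * H)) * c ^ 3 * τ ^ (3 - 2 * H) = (c * τ) ^ (3 - 2 * H) := by
    intro c hc
    rw [Real.mul_rpow hc.le hτ0.le, ← Real.rpow_natCast, ← Real.rpow_add hc]
    congr 2; push_cast; ring
  have hlow : ∀ j : ℤ, (b * a ^ j * τ) ^ (3 - 2 * H) * (D * Real.exp (-(b * a ^ j * (t + τ)))) ≤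
      τ ^ (3 - 2 * H) * ((b * a ^ j) ^ (-(2 * H)) *
      ((Real.exp (-(b * a ^ j * (s + τ))) - Real.exp (-(b * a ^ j * (t + τ)))) *
      (Real.cosh (b * a ^ j * v) - Real.cosh (b * a ^ j * u)))) := by
    intro j
    have hc : 0 < b * a ^ j := by positivity
    have := aux_term_lower (b * a ^ j) u v (s + τ) (t + τ) hc hu huv (by linarith)
    rw [← hcr _ hc]
    have h := mul_le_mul_of_nonneg_left this
      (show 0 ≤ τ ^ (3 - 2 * H) * (b * a ^ j) ^ (-(2 * H)) by positivity)
    rw [hD]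
    refine le_trans (le_of_eq ?_) (h.trans (le_of_eq ?_)) <;> ring
  constructor
  · have := le_hasSum hsum2 n (fun j _ => le_trans (by positivity) (hlow j))
    refine le_trans ?_ this
    refine le_trans ?_ (hlow n)
    gcongr
    have : b * a ^ n * t ≤ t := by
      have : b * a ^ n ≤ 1 := by
        have : 0 < b * a ^ n := by positivity
        nlinarith
      nlinarith
    nlinarith
  · have hS2 := (((Equiv.addRight (-n)).hasSum_iff.2 hS.hasSum)).mul_left D
    refine hasSum_le (fun j => ?_) hsum2 hS2
    have hc : 0 < b * a ^ j := by positivity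
    have h := mul_le_mul_of_nonneg_left (aux_term_upper (b * a ^ j) u v s t τ hc hu huv hvs hst)
      (show 0 ≤ τ ^ (3 - 2 * H) * (b * a ^ j) ^ (-(2 * H)) by positivity)
    rw [← hD] at h
    have e : b * a ^ j * τ = (b * a ^ n * τ) * a ^ (j + -n) := by
      rw [zpow_add₀ ha0.ne', zpow_neg]; field_simp
    have hw : 0 < a ^ (j + -n) := by positivity
    calc _ = _ := by rw [← mul_assoc]
      _ ≤ _ := h
      _ = D * ((b * a ^ j * τ) ^ (3 - 2 * H) * Real.exp (-(b * a ^ j * τ))) := by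
        rw [← hcr _ hc]; ring
      _ ≤ _ := by
        rw [e]
        simp only [Function.comp, Equiv.coe_addRight, one_mul]
        gcongr
        nlinarith

lemma aux_final (f : ℝ → ℝ) (m M : ℝ) (hm : 0 < m)
    (h : ∀ τ : ℝ, 1 ≤ τ → m ≤ f τ ∧ f τ ≤ M) :
    0 < Filter.liminf (fun τ : ℝ => ((f τ : ℝ) : EReal)) Filter.atTop ∧
    Filter.liminf (fun τ : ℝ => ((f τ : ℝ) : EReal)) Filter.atTop
      ≤ Filter.limsup (fun τ : ℝ => ((f τ : ℝ) : EReal)) Filter.atTop ∧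
    Filter.limsup (fun τ : ℝ => ((f τ : ℝ) : EReal)) Filter.atTop < (⊤ : EReal) := by
  refine ⟨?_, Filter.liminf_le_limsup, ?_⟩
  · refine lt_of_lt_of_le (EReal.coe_pos.2 hm) (Filter.le_liminf_of_le (by isBoundedDefault) ?_)
    filter_upwards [Filter.eventually_ge_atTop 1] with τ hτ
    exact EReal.coe_le_coe_iff.2 (h τ hτ).1
  · refine lt_of_le_of_lt (Filter.limsup_le_of_le (by isBoundedDefault) ?_) (EReal.coe_lt_top M)
    filter_upwards [Filter.eventually_ge_atTop 1] with τ hτ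
    exact EReal.coe_le_coe_iff.2 (h τ hτ).2

lemma aux_bound (H k : ℝ) (r : ℕ) (h : ∀ y, 0 < y → |phiK k y| ≤ y ^ r) (y : ℝ) (hy : 0 < y) :
    |y ^ (-(2 * H)) * phiK k y| ≤ 1 * y ^ ((r : ℝ) - 2 * H) := by
  rw [abs_mul, abs_of_pos (by positivity : 0 < y ^ (-(2 * H))), one_mul, sub_eq_add_neg,
    Real.rpow_add hy, Real.rpow_natCast, mul_comm]
  exact mul_le_mul_of_nonneg_right (h y hy) (by positivity)

lemma aux_exp_upper (y : ℝ) (hy : 0 < y) : Real.exp (-y) ≤ 1 - y + y ^ 2 / 2 := by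
  have h := Real.quadratic_le_exp_of_nonneg hy.le
  have h2 : Real.exp (-y) * Real.exp y = 1 := by rw [← Real.exp_add]; simp
  have h3 : 0 < Real.exp y := Real.exp_pos y
  have h4 : 0 < 1 - y + y ^ 2 / 2 := by nlinarith [sq_nonneg (y - 1)]
  have h5 : 1 ≤ (1 - y + y ^ 2 / 2) * Real.exp y := by
    have := mul_le_mul_of_nonneg_left h h4.le
    nlinarith [sq_nonneg (y ^ 2)]
  exact le_of_mul_le_mul_right (h2.le.trans h5) h3

lemma aux_exp_lower (y : ℝ) (hy : 0 < y) : 1 - y + y ^ 2 / 2 - y ^ 3 ≤ Real.exp (-y) := by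
  rcases le_total y 1 with h | h
  · have := Real.exp_bound (x := -y) (by rw [abs_neg, abs_of_pos hy]; exact h) (n := 3) (by norm_num)
    rw [abs_neg, abs_of_pos hy] at this
    have := (abs_le.1 this).1
    norm_num [Finset.sum_range_succ, Nat.factorial] at this
    have : 0 < y ^ 3 := by positivity
    linarith
  · have := Real.exp_pos (-y)
    nlinarith [mul_nonneg (sub_nonneg.2 h) (sq_nonneg y)]

theorem stmt17 (a b : ℝ) (ha0 : 0 < a) (ha1 : a < 1) (hb : 0 < b) (H : ℝ)
    (u v s t : ℝ) (hu : 0 ≤ u) (huv : u < v) (hvs : v ≤ s) (hst : s < t) :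
    (1 / 2 < H → H < 1 →
      0 < Filter.liminf
          (fun τ : ℝ => ((τ ^ (3 - 2 * H) * incCov (Qcov a b H) u v s t τ : ℝ) : EReal))
          Filter.atTop ∧
      Filter.liminf
          (fun τ : ℝ => ((τ ^ (3 - 2 * H) * incCov (Qcov a b H) u v s t τ : ℝ) : EReal))
          Filter.atTop
        ≤ Filter.limsup
          (fun τ : ℝ => ((τ ^ (3 - 2 * H) * incCov (Qcov a b H) u v s t τ : ℝ) : EReal))
          Filter.atTop ∧
      Filter.limsup
          (fun τ : ℝ => ((τ ^ (3 - 2 * H) * incCov (Qcov a b H) u v s t τ : ℝ) : EReal))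
          Filter.atTop < (⊤ : EReal)) ∧
    (1 < H → H < 3 / 2 →
      0 < Filter.liminf
          (fun τ : ℝ => ((τ ^ (3 - 2 * H) * incCov (Qtil a b H) u v s t τ : ℝ) : EReal))
          Filter.atTop ∧
      Filter.liminf
          (fun τ : ℝ => ((τ ^ (3 - 2 * H) * incCov (Qtil a b H) u v s t τ : ℝ) : EReal))
          Filter.atTop
        ≤ Filter.limsup
          (fun τ : ℝ => ((τ ^ (3 - 2 * H) * incCov (Qtil a b H) u v s t τ : ℝ) : EReal))
          Filter.atTop ∧
      Filter.limsup
          (fun τ : ℝ => ((τ ^ (3 - 2 * H) * incCov (Qtil a b H) u v s t τ : ℝ) : EReal))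
          Filter.atTop < (⊤ : EReal)) := by
  have e1 : Qcov a b H = Qgen a b H 0 := by
    funext x y
    simp only [Qcov, Qgen, hosc, phiK, zero_mul, sub_zero]
  have e2 : Qtil a b H = Qgen a b H (1 / 2) := by
    funext x y
    simp only [Qtil, Qgen, htil, phiK, div_eq_inv_mul, mul_one]
  constructor
  · intro h1 h2
    obtain ⟨m, M, hm, h⟩ := aux_main a b H 0 (((2 : ℕ) : ℝ) - 2 * H) (2 * H - ((1 : ℕ) : ℝ)) 1
      ha0 ha1 hb (by linarith) (by linarith) (by push_cast; linarith) (by push_cast; linarith)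
      (aux_bound H 0 2 fun y hy => by
        have := aux_exp_upper y hy
        have := Real.add_one_le_exp (-y)
        rw [phiK, abs_le]; constructor <;> nlinarith [sq_nonneg y])
      (by
        rw [neg_sub]
        exact aux_bound H 0 1 fun y hy => by
          have : Real.exp (-y) ≤ 1 := Real.exp_le_one_iff.2 (by linarith)
          have := Real.add_one_le_exp (-y)
          rw [phiK, abs_le]; constructor <;> linarith)
      u v s t hu huv hvs hst
    rw [e1]
    exact aux_final _ m M hm h
  · intro h1 h2
    obtain ⟨m, M, hm, h⟩ := aux_main a b H (1 / 2) (((3 : ℕ) : ℝ) - 2 * H) (2 * H - ((2 : ℕ) : ℝ)) 1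
      ha0 ha1 hb (by linarith) (by linarith) (by push_cast; linarith) (by push_cast; linarith)
      (aux_bound H (1 / 2) 3 fun y hy => by
        have := aux_exp_upper y hy
        have := aux_exp_lower y hy
        have : 0 < y ^ 3 := by positivity
        rw [phiK, abs_le]; constructor <;> linarith)
      (by
        rw [neg_sub]
        exact aux_bound H (1 / 2) 2 fun y hy => by
          have := aux_exp_upper y hy
          have := Real.add_one_le_exp (-y)
          rw [phiK, abs_le]; constructor <;> nlinarith [sq_nonneg y])
      u v s t hu huv hvs hst
    rw [e2]
    exact aux_final _ m M hm h
end

section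
/- Let M ≥ 2 be an integer and let c be a real number with 1 < c < M. Set b = (M² - c)/(M(M-1)), A = (M - c)/(M b (c-1)) and D = ((M-1)/(M b)) · (c/(c-1)). Define the potential kernel G on Ω_M by G(0) = D and G(y) = A / c^{|y|-1} for y ≠ 0. Then for all integers 0 ≤ s ≤ t, Σ_{x ∈ B_s} Σ_{y ∈ B_t} G(x - y) = D · M^s · (M/c)^t. (This computes the covariance E ϑ̃_s ϑ̃_t = 2 D M^{s∧t} (M/c)^{s∨t} of the spatial process ϑ̃_t = ⟨X(1), 1_{B_t}⟩ in Theorem 2.19.) -/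
open Real

/-- The hierarchical distance `|x|` of an element of the hierarchical group
`Ω_M = ⊕_{i≥1} ℤ/Mℤ` (modelled as finitely supported functions `ℕ →₀ ZMod M`, with
coordinate `i : ℕ` playing the role of the coordinate `x_{i+1}`): `|x| = 0` if `x = 0`
and otherwise `|x| = max { i+1 : x_i ≠ 0 }`, so that the ball `B_n = {x : |x| ≤ n}`
has exactly `M^n` elements. -/
def hnorm {M : ℕ} (x : ℕ →₀ ZMod M) : ℕ :=
  x.support.sup (· + 1)

/-- The potential kernel `G` on `Ω_M`: `G(0) = D` and `G(y) = A / c^{|y|-1}` for `y ≠ 0`. -/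
noncomputable def Gker (M : ℕ) (c A D : ℝ) (y : ℕ →₀ ZMod M) : ℝ :=
  if y = 0 then D else A / c ^ (hnorm y - 1)

lemma hnorm_le_iff {M : ℕ} (x : ℕ →₀ ZMod M) (n : ℕ) :
    hnorm x ≤ n ↔ x.support ⊆ Finset.range n := by
  unfold hnorm
  rw [Finset.sup_le_iff]
  constructor
  · intro h i hi
    have := h i hi
    rw [Finset.mem_range]; omega
  · intro h i hi
    have := Finset.mem_range.1 (h hi)
    omega

noncomputable def hball (M : ℕ) [NeZero M] (n : ℕ) : Finset (ℕ →₀ ZMod M) :=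
  Finset.finsupp (Finset.range n) (fun _ => Finset.univ)

lemma mem_hball {M : ℕ} [NeZero M] (n : ℕ) (x : ℕ →₀ ZMod M) :
    x ∈ hball M n ↔ hnorm x ≤ n := by
  rw [hnorm_le_iff, hball, Finset.mem_finsupp_iff]
  simp

lemma card_hball (M : ℕ) [NeZero M] (n : ℕ) : (hball M n).card = M ^ n := by
  rw [hball, Finset.card_finsupp]
  simp [ZMod.card]

lemma tsum_hball {M : ℕ} [NeZero M] (n : ℕ) (f : (ℕ →₀ ZMod M) → ℝ) :
    ∑' x : {x : ℕ →₀ ZMod M // hnorm x ≤ n}, f x = ∑ x ∈ hball M n, f x := by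
  rw [← Finset.tsum_subtype]
  exact (Equiv.subtypeEquivRight (fun x => (mem_hball n x).symm)).tsum_eq
    (fun x : {x // x ∈ hball M n} => f x)

lemma sub_mem_hball {M : ℕ} [NeZero M] {n : ℕ} {x y : ℕ →₀ ZMod M}
    (hx : x ∈ hball M n) (hy : y ∈ hball M n) : x - y ∈ hball M n := by
  rw [mem_hball, hnorm_le_iff] at *
  exact Finsupp.support_sub.trans (Finset.union_subset hx hy)

lemma hball_mono {M : ℕ} [NeZero M] {s t : ℕ} (h : s ≤ t) : hball M s ⊆ hball M t := by
  intro x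
  rw [mem_hball, mem_hball]
  omega

lemma sum_Gker (M : ℕ) [NeZero M] (c A D : ℝ) (hc : c ≠ 0)
    (hAD : ((M : ℝ) - 1) * A = D * (M / c - 1)) (n : ℕ) :
    ∑ y ∈ hball M n, Gker M c A D y = D * ((M : ℝ) / c) ^ n := by
  induction n with
  | zero =>
    have : hball M 0 = {0} := by
      ext x
      rw [mem_hball, hnorm_le_iff]
      simp
    simp [this, Gker]
  | succ n ih =>
    rw [← Finset.sum_sdiff (hball_mono (M := M) (Nat.le_succ n)), ih]
    have h : ∀ y ∈ hball M (n+1) \ hball M n, Gker M c A D y = A / c ^ n := by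
      intro y hy
      rw [Finset.mem_sdiff, mem_hball, mem_hball] at hy
      have h1 : hnorm y = n + 1 := by omega
      have h0 : y ≠ 0 := by
        rintro rfl
        simp [hnorm] at h1
      simp [Gker, h0, h1]
    rw [Finset.sum_congr rfl h, Finset.sum_const, nsmul_eq_mul, Finset.cast_card_sdiff (hball_mono (Nat.le_succ n)),
      card_hball, card_hball]
    push_cast
    have e : ((M : ℝ) ^ (n+1) - M ^ n) * (A / c ^ n) = (M / c) ^ n * (((M : ℝ) - 1) * A) := by
      rw [div_pow]; ring
    rw [e, hAD]
    ring

theorem stmt19 (M : ℕ) (hM : 2 ≤ M) (c : ℝ) (hc1 : 1 < c) (hcM : c < M)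
    (b A D : ℝ)
    (hb : b = ((M : ℝ) ^ 2 - c) / (M * (M - 1)))
    (hA : A = ((M : ℝ) - c) / (M * b * (c - 1)))
    (hD : D = (((M : ℝ) - 1) / (M * b)) * (c / (c - 1)))
    (s t : ℕ) (hst : s ≤ t) :
    (∑' x : {x : ℕ →₀ ZMod M // hnorm x ≤ s}, ∑' y : {y : ℕ →₀ ZMod M // hnorm y ≤ t},
      Gker M c A D ((x : ℕ →₀ ZMod M) - (y : ℕ →₀ ZMod M)))
    = D * (M : ℝ) ^ s * ((M : ℝ) / c) ^ t := by
  haveI : NeZero M := ⟨by omega⟩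
  have hM' : (2 : ℝ) ≤ M := by exact_mod_cast hM
  have hAD : ((M : ℝ) - 1) * A = D * (M / c - 1) := by
    have h1 : c - 1 ≠ 0 := by linarith
    have h2 : b ≠ 0 := by
      rw [hb]
      apply ne_of_gt
      apply div_pos
      · nlinarith
      · apply mul_pos <;> linarith
    have h3 : c ≠ 0 := by linarith
    have h4 : (M : ℝ) ≠ 0 := by linarith
    rw [hA, hD]
    clear hb
    field_simp
  rw [tsum_hball s (fun x => ∑' y : {y : ℕ →₀ ZMod M // hnorm y ≤ t},
      Gker M c A D (x - (y : ℕ →₀ ZMod M)))]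
  have h : ∀ x ∈ hball M s, ∑' y : {y : ℕ →₀ ZMod M // hnorm y ≤ t},
      Gker M c A D (x - (y : ℕ →₀ ZMod M)) = D * ((M : ℝ) / c) ^ t := by
    intro x hx
    have hx' := hball_mono hst hx
    rw [tsum_hball t (fun y => Gker M c A D (x - y)),
      ← sum_Gker M c A D (by linarith) hAD t]
    exact Finset.sum_nbij' (fun y => x - y) (fun y => x - y)
      (fun y hy => sub_mem_hball hx' hy) (fun y hy => sub_mem_hball hx' hy)
      (by simp) (by simp) (by simp)
  rw [Finset.sum_congr rfl h, Finset.sum_const, nsmul_eq_mul, card_hball]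
  push_cast
  ring
end
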